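/- Let k ≥ 0, d ≥ 1 be integers and s = (k+1)/d. There exists a constant c > 0 depending only on k and d such that for every N > k+1 with n = N^d ≥ 2, every σ > 0, and every 0 < C_n ≤ n, the minimax risk over the KTV class satisfies R( 𝒯_{n,d}^k(C_n) ) ≥ c [ (k+1)^d σ²/n + min( σ C_n / n, σ² ) + min( (C_n/n)^{2/(2s+1)} σ^{4s/(2s+1)}, σ² ) ]. -/

import Mathlib

open scoped BigOperators ENNReal NNReal
open MeasureTheory ProbabilityTheory Matrix

noncomputable section

/-- Univariate forward difference matrix `D^{(1)}_M ∈ ℝ^{(M-1)×M}`, with entries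
`(D^{(1)}_M)_{i,i} = -1`, `(D^{(1)}_M)_{i,i+1} = 1` and `0` otherwise. -/
def D1 (M : ℕ) : Matrix (Fin (M - 1)) (Fin M) ℝ :=
  Matrix.of fun i j => if (j : ℕ) = (i : ℕ) then -1 else if (j : ℕ) = (i : ℕ) + 1 then 1 else 0

/-- Univariate difference operator of order `m` on `N` points:
`D^{(0)}_N = I_N` and `D^{(m+1)}_N = D^{(1)}_{N-m} D^{(m)}_N`.  In particular
`Dop N (k+1)` is the operator `D_N^{(k+1)} ∈ ℝ^{(N-k-1) × N}`. -/
def Dop (N : ℕ) : (m : ℕ) → Matrix (Fin (N - m)) (Fin N) ℝ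
  | 0 => Matrix.of fun i j => if (i : ℕ) = (j : ℕ) then 1 else 0
  | m + 1 => D1 (N - m) * Dop N m

/-- Row index type of the order-`m` KTF penalty matrix: a coordinate direction `j`,
a row index of the univariate operator, and the values of the other `d-1` lattice
coordinates. -/
abbrev KtfIdx (N d m : ℕ) :=
  Σ j : Fin d, Fin (N - m) × ({l : Fin d // l ≠ j} → Fin N)

/-- Order-`m` KTF penalty matrix on the lattice `{1,…,N}^d`: the vertical block
concatenation over coordinate directions `j` of `I_N ⊗ ⋯ ⊗ D^{(m)}_N ⊗ ⋯ ⊗ I_N`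
(`D^{(m)}_N` in the `j`-th factor). -/
def ktfMat (N d m : ℕ) : Matrix (KtfIdx N d m) (Fin d → Fin N) ℝ :=
  Matrix.of fun p x =>
    Dop N m p.2.1 (x p.1) *
      ∏ l : {l : Fin d // l ≠ p.1}, (if p.2.2 l = x l.1 then (1:ℝ) else 0)

/-- Product Gaussian measure with coordinatewise means `θ0` and variance `σ^2`. -/
def gaussSeq {ι : Type*} [Fintype ι] (θ0 : ι → ℝ) (σ : ℝ) : Measure (ι → ℝ) :=
  Measure.pi fun i => gaussianReal (θ0 i) (Real.toNNReal (σ ^ 2))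

/-- Normalized expected squared error `(1/n) E‖θhat(y) - θ0‖₂²` of the estimator
`θhat` when `y` has independent `N(θ0 i, σ²)` coordinates (value in `ℝ≥0∞`). -/
def riskE {ι : Type*} [Fintype ι] (θhat : (ι → ℝ) → ι → ℝ) (θ0 : ι → ℝ) (σ : ℝ) : ℝ≥0∞ :=
  (Fintype.card ι : ℝ≥0∞)⁻¹ * ∫⁻ y, ENNReal.ofReal (∑ i, (θhat y i - θ0 i) ^ 2) ∂(gaussSeq θ0 σ)

/-- Minimax risk over a parameter set `K`: infimum over measurable estimators of the
worst-case normalized expected squared error. -/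
def minimaxRisk {ι : Type*} [Fintype ι] (K : Set (ι → ℝ)) (σ : ℝ) : ℝ≥0∞ :=
  ⨅ θhat : {f : (ι → ℝ) → ι → ℝ // Measurable f}, ⨆ θ0 ∈ K, riskE θhat.1 θ0 σ

/-- Minimax linear risk over a parameter set `K`: infimum over linear estimators
`y ↦ S y`. -/
def minimaxLinearRisk {ι : Type*} [Fintype ι] [DecidableEq ι] (K : Set (ι → ℝ)) (σ : ℝ) : ℝ≥0∞ :=
  ⨅ S : Matrix ι ι ℝ, ⨆ θ0 ∈ K, riskE (fun y => S.mulVec y) θ0 σ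

/-- Change of mean for one-dimensional Gaussian measures. -/
lemma gaussianReal_eq_withDensity_gaussianReal (a b : ℝ) {v : ℝ≥0} (hv : v ≠ 0) :
    gaussianReal b v = (gaussianReal a v).withDensity fun y =>
      ENNReal.ofReal (Real.exp (((y - a) * (b - a) - (b - a) ^ 2 / 2) / v)) := by
  rw [gaussianReal_of_var_ne_zero _ hv, gaussianReal_of_var_ne_zero _ hv,
    ← withDensity_mul _ (measurable_gaussianPDF a v) (by fun_prop)]
  congr 1
  ext y
  rw [Pi.mul_apply, gaussianPDF, gaussianPDF, ← ENNReal.ofReal_mul (gaussianPDFReal_nonneg _ _ _),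
    gaussianPDFReal, gaussianPDFReal, mul_assoc (√(2 * Real.pi * v))⁻¹, ← Real.exp_add]
  have hv' : (v : ℝ) ≠ 0 := by exact_mod_cast hv
  congr 3
  field_simp
  ring

instance isProbabilityMeasure_gaussSeq {ι : Type*} [Fintype ι] (θ : ι → ℝ) (σ : ℝ) :
    IsProbabilityMeasure (gaussSeq θ σ) := by
  unfold gaussSeq
  infer_instance

/-- Change of mean for product Gaussian measures. -/
lemma gaussSeq_eq_withDensity {ι : Type*} [Fintype ι] (θ θ' : ι → ℝ) {σ : ℝ} (hσ : 0 < σ) :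
    gaussSeq θ' σ = (gaussSeq θ σ).withDensity fun y =>
      ENNReal.ofReal (Real.exp
        ((∑ i, (y i - θ i) * (θ' i - θ i) - (∑ i, (θ' i - θ i) ^ 2) / 2) / σ ^ 2)) := by
  have hv : Real.toNNReal (σ ^ 2) ≠ 0 := by
    have : 0 < Real.toNNReal (σ ^ 2) := by rw [Real.toNNReal_pos]; positivity
    exact this.ne'
  have hvσ : ((Real.toNNReal (σ ^ 2) : ℝ≥0) : ℝ) = σ ^ 2 := Real.coe_toNNReal _ (by positivity)
  set f : ι → ℝ → ℝ≥0∞ := fun i y => ENNReal.ofReal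
    (Real.exp (((y - θ i) * (θ' i - θ i) - (θ' i - θ i) ^ 2 / 2) / σ ^ 2)) with hf
  have hfm : ∀ i, Measurable (f i) := fun i => by simp only [hf]; fun_prop
  have hprod : (fun y : ι → ℝ => ENNReal.ofReal (Real.exp
        ((∑ i, (y i - θ i) * (θ' i - θ i) - (∑ i, (θ' i - θ i) ^ 2) / 2) / σ ^ 2))) =
      fun y => ∏ i, f i (y i) := by
    ext y
    rw [← ENNReal.ofReal_prod_of_nonneg (fun i _ => (Real.exp_pos _).le), ← Real.exp_sum,
      ← Finset.sum_div, Finset.sum_sub_distrib, Finset.sum_div]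
  rw [hprod]
  unfold gaussSeq
  refine Measure.pi_eq fun s hs => ?_
  have hbox : MeasurableSet (Set.univ.pi s) := MeasurableSet.univ_pi hs
  have hmeas : ∀ i, Measurable ((s i).indicator (f i)) := fun i => (hfm i).indicator (hs i)
  rw [withDensity_apply _ hbox, ← lintegral_indicator hbox]
  have hind : (Set.univ.pi s).indicator (fun y : ι → ℝ => ∏ i, f i (y i)) =
      fun y => ∏ i, (s i).indicator (f i) (y i) := by
    ext y
    by_cases hy : y ∈ Set.univ.pi s
    · rw [Set.indicator_of_mem hy]
      exact Finset.prod_congr rfl fun i _ => by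
        rw [Set.indicator_of_mem (hy i (Set.mem_univ i))]
    · rw [Set.indicator_of_notMem hy]
      simp only [Set.mem_pi, Set.mem_univ, true_imp_iff, not_forall] at hy
      obtain ⟨i, hi⟩ := hy
      exact (Finset.prod_eq_zero (Finset.mem_univ i) (Set.indicator_of_notMem hi _)).symm
  rw [hind, lintegral_prod_eq_prod_lintegral_of_indepFun Finset.univ
    (fun i (y : ι → ℝ) => (s i).indicator (f i) (y i))
    (iIndepFun_pi fun i => (hmeas i).aemeasurable)
    (fun i => (hmeas i).comp (measurable_pi_apply i))]
  refine Finset.prod_congr rfl fun i _ => ?_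
  rw [(measurePreserving_eval (fun i => gaussianReal (θ i) (Real.toNNReal (σ ^ 2))) i).lintegral_comp
    (hmeas i), lintegral_indicator (hs i), ← withDensity_apply _ (hs i),
    gaussianReal_eq_withDensity_gaussianReal (θ i) (θ' i) hv, hvσ]

/-- A half-space through the mean has probability at least one half. -/
lemma half_le_gaussSeq_halfspace {ι : Type*} [Fintype ι] (θ δ : ι → ℝ) (σ : ℝ) :
    ENNReal.ofReal (1 / 2) ≤ gaussSeq θ σ {y | 0 ≤ ∑ i, (y i - θ i) * δ i} := by
  set H : Set (ι → ℝ) := {y | 0 ≤ ∑ i, (y i - θ i) * δ i} with hH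
  have hHm : MeasurableSet H := measurableSet_le (by fun_prop) (by fun_prop)
  have hT : MeasurePreserving (fun (y : ι → ℝ) i => (fun i (t : ℝ) => 2 * θ i - t) i (y i))
      (gaussSeq θ σ) (gaussSeq θ σ) := by
    refine measurePreserving_pi _ _ fun i => ⟨by fun_prop, ?_⟩
    rw [gaussianReal_map_const_sub]
    congr 1
    ring
  have hcover : (Set.univ : Set (ι → ℝ)) ⊆
      H ∪ (fun (y : ι → ℝ) i => 2 * θ i - y i) ⁻¹' H := by
    intro y _
    rcases le_total 0 (∑ i, (y i - θ i) * δ i) with h | h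
    · exact Or.inl h
    · refine Or.inr ?_
      have : ∑ i, (2 * θ i - y i - θ i) * δ i = -∑ i, (y i - θ i) * δ i := by
        rw [← Finset.sum_neg_distrib]
        exact Finset.sum_congr rfl fun i _ => by ring
      change 0 ≤ ∑ i, (2 * θ i - y i - θ i) * δ i
      rw [this]
      linarith
  have h1 : (1 : ℝ≥0∞) ≤ gaussSeq θ σ H + gaussSeq θ σ H := by
    calc (1 : ℝ≥0∞) = gaussSeq θ σ Set.univ := measure_univ.symm
      _ ≤ _ := measure_mono hcover
      _ ≤ _ := measure_union_le _ _
      _ = _ := by rw [hT.measure_preimage hHm.nullMeasurableSet]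
  rw [← ENNReal.toReal_le_toReal (by simp) (by finiteness),
    ENNReal.toReal_add (by finiteness) (by finiteness)] at h1
  rw [ENNReal.ofReal_le_iff_le_toReal (by finiteness)]
  simp only [ENNReal.toReal_one] at h1
  linarith

/-- Le Cam's two-point bound: if two Gaussian means are at distance at most `2σ`, then two
losses that add up to at least `D` everywhere cannot both have small expectation. -/
lemma le_lintegral_add_lintegral_gaussSeq {ι : Type*} [Fintype ι] {θ θ' : ι → ℝ} {σ : ℝ}
    (hσ : 0 < σ) (hδ : ∑ i, (θ' i - θ i) ^ 2 ≤ 4 * σ ^ 2) {A A' : (ι → ℝ) → ℝ≥0∞}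
    (hA : Measurable A) (hA' : Measurable A') {D : ℝ≥0∞} (hD : ∀ y, D ≤ A y + A' y) :
    ENNReal.ofReal (Real.exp (-2) / 2) * D ≤
      ∫⁻ y, A y ∂(gaussSeq θ σ) + ∫⁻ y, A' y ∂(gaussSeq θ' σ) := by
  set P := gaussSeq θ σ with hP
  set H : Set (ι → ℝ) := {y | 0 ≤ ∑ i, (y i - θ i) * (θ' i - θ i)} with hH
  have hHm : MeasurableSet H := measurableSet_le (by fun_prop) (by fun_prop)
  set L : (ι → ℝ) → ℝ≥0∞ := fun y => ENNReal.ofReal (Real.exp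
        ((∑ i, (y i - θ i) * (θ' i - θ i) - (∑ i, (θ' i - θ i) ^ 2) / 2) / σ ^ 2)) with hL
  have hLm : Measurable L := by simp only [hL]; fun_prop
  set e : ℝ≥0∞ := ENNReal.ofReal (Real.exp (-2)) with he
  have he1 : e ≤ 1 := by
    rw [he, ← ENNReal.ofReal_one]
    exact ENNReal.ofReal_le_ofReal (Real.exp_le_one_iff.2 (by norm_num))
  have hLH : ∀ y ∈ H, e ≤ L y := by
    intro y hy
    refine ENNReal.ofReal_le_ofReal (Real.exp_le_exp.2 ?_)
    rw [le_div_iff₀ (by positivity)]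
    have hy' : 0 ≤ ∑ i, (y i - θ i) * (θ' i - θ i) := hy
    linarith
  have hA'int : ∫⁻ y, A' y ∂(gaussSeq θ' σ) = ∫⁻ y, L y * A' y ∂P := by
    rw [gaussSeq_eq_withDensity θ θ' hσ, lintegral_withDensity_eq_lintegral_mul _ hLm hA']
    rfl
  calc ENNReal.ofReal (Real.exp (-2) / 2) * D
      = e * D * ENNReal.ofReal (1 / 2) := by
        rw [div_eq_mul_one_div, ENNReal.ofReal_mul (Real.exp_pos _).le]
        ring
    _ ≤ e * D * P H := by gcongr; exact half_le_gaussSeq_halfspace _ _ _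
    _ = ∫⁻ _ in H, e * D ∂P := by rw [setLIntegral_const]
    _ ≤ ∫⁻ y in H, (A y + L y * A' y) ∂P := by
        refine setLIntegral_mono (hA.add (hLm.mul hA')) fun y hy => ?_
        calc e * D ≤ e * (A y + A' y) := by gcongr; exact hD y
          _ = e * A y + e * A' y := mul_add _ _ _
          _ ≤ 1 * A y + L y * A' y := by gcongr; exact hLH y hy
          _ = _ := by rw [one_mul]
    _ ≤ ∫⁻ y, (A y + L y * A' y) ∂P := setLIntegral_le_lintegral _ _
    _ = _ := by rw [lintegral_add_left hA, hA'int]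

/-- The sign attached to a Boolean. -/
def boolSign (b : Bool) : ℝ := if b then 1 else -1

/-- Assouad's bound over a hypercube spanned by disjointly supported vectors of length `σ`. -/
lemma le_minimaxRisk_of_hypercube {ι J : Type*} [Fintype ι] [Nonempty ι] [Fintype J] {σ : ℝ}
    (hσ : 0 < σ)
    (v : J → ι → ℝ) (hdisj : ∀ i j j', v j i ≠ 0 → v j' i ≠ 0 → j = j')
    (hv : ∀ j, ∑ i, v j i ^ 2 = σ ^ 2) (K : Set (ι → ℝ))
    (hK : ∀ ε : J → ℝ, (∀ j, |ε j| = 1) → (fun i => ∑ j, ε j * v j i) ∈ K) :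
    ENNReal.ofReal (Real.exp (-2) / 2 * (Fintype.card J * σ ^ 2 / Fintype.card ι)) ≤
      minimaxRisk K σ := by
  classical
  refine le_iInf fun ⟨f, hf⟩ => ?_
  set R := ⨆ θ0 ∈ K, riskE f θ0 σ with hR
  change _ ≤ R
  set θ : (J → Bool) → ι → ℝ := fun ε i => ∑ j, boolSign (ε j) * v j i with hθ
  have habs : ∀ b, |boolSign b| = 1 := fun b => by cases b <;> simp [boolSign]
  have hsq : ∀ b, boolSign b ^ 2 = 1 := fun b => by cases b <;> simp [boolSign]
  have hnot : ∀ b, boolSign (!b) = -boolSign b := fun b => by cases b <;> simp [boolSign]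
  have hrisk : ∀ ε, riskE f (θ ε) σ ≤ R := fun ε =>
    le_iSup₂ (f := fun θ0 (_ : θ0 ∈ K) => riskE f θ0 σ) (θ ε) (hK _ fun j => habs _)
  -- the part of the loss that is charged to the vector `v j`
  set A : J → (J → Bool) → (ι → ℝ) → ℝ≥0∞ := fun j ε y => ENNReal.ofReal
    (∑ i, if v j i = 0 then 0 else (f y i - boolSign (ε j) * v j i) ^ 2) with hA
  have hfi : ∀ i, Measurable fun y => f y i := fun i => (measurable_pi_apply i).comp hf
  have hAm : ∀ j ε, Measurable (A j ε) := fun j ε => by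
    refine ENNReal.measurable_ofReal.comp (Finset.measurable_fun_sum _ fun i _ => ?_)
    split_ifs
    · exact measurable_const
    · have := hfi i
      fun_prop
  have hsplit : ∀ ε y, ∑ j, A j ε y ≤ ENNReal.ofReal (∑ i, (f y i - θ ε i) ^ 2) := by
    intro ε y
    simp only [hA]
    rw [← ENNReal.ofReal_sum_of_nonneg fun j _ => Finset.sum_nonneg fun i _ => by
      split_ifs <;> positivity]
    refine ENNReal.ofReal_le_ofReal ?_
    rw [Finset.sum_comm]
    refine Finset.sum_le_sum fun i _ => ?_
    by_cases h : ∃ j, v j i ≠ 0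
    · obtain ⟨j, hj⟩ := h
      have hz : ∀ j' ∈ Finset.univ, j' ≠ j → v j' i = 0 := fun j' _ hne => by
        by_contra h0
        exact hne (hdisj i j' j h0 hj)
      rw [Finset.sum_eq_single j (fun j' h1 h2 => if_pos (hz j' h1 h2)) (by simp), if_neg hj]
      simp only [hθ]
      rw [Finset.sum_eq_single j (fun j' h1 h2 => by rw [hz j' h1 h2, mul_zero]) (by simp)]
    · push Not at h
      simp only [h, if_true, Finset.sum_const_zero]
      positivity
  set E : J → (J → Bool) → ℝ≥0∞ := fun j ε => ∫⁻ y, A j ε y ∂(gaussSeq (θ ε) σ) with hE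
  have hEsum : ∀ ε, (Fintype.card ι : ℝ≥0∞)⁻¹ * ∑ j, E j ε ≤ R := by
    intro ε
    refine le_trans ?_ (hrisk ε)
    unfold riskE
    gcongr
    simp only [hE]
    rw [← lintegral_finsetSum _ fun j _ => hAm j ε]
    exact lintegral_mono fun y => hsplit ε y
  set q : ℝ≥0∞ := ENNReal.ofReal (Real.exp (-2) / 2) * ENNReal.ofReal (2 * σ ^ 2) with hq
  let flip : J → (J → Bool) → (J → Bool) := fun j ε => Function.update ε j (!(ε j))
  have hflip : ∀ j, Function.Involutive (flip j) := by
    intro j ε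
    simp [flip]
  have hpair : ∀ j ε, q ≤ E j ε + E j (flip j ε) := by
    intro j ε
    refine le_lintegral_add_lintegral_gaussSeq hσ ?_ (hAm j ε) (hAm j (flip j ε)) ?_
    · have hd : ∀ i, θ (flip j ε) i - θ ε i = -2 * boolSign (ε j) * v j i := by
        intro i
        simp only [hθ]
        rw [← Finset.sum_sub_distrib, Finset.sum_eq_single j]
        · simp only [flip, Function.update_self, hnot]
          ring
        · intro j' _ hne
          simp [flip, Function.update_of_ne hne]
        · simp
      simp only [hd, mul_pow, hsq]
      rw [← Finset.mul_sum, hv j]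
      norm_num
    · intro y
      simp only [hA, flip, Function.update_self, hnot]
      rw [← ENNReal.ofReal_add (Finset.sum_nonneg fun i _ => by split_ifs <;> positivity)
        (Finset.sum_nonneg fun i _ => by split_ifs <;> positivity)]
      refine ENNReal.ofReal_le_ofReal ?_
      rw [← hv j, Finset.mul_sum, ← Finset.sum_add_distrib]
      refine Finset.sum_le_sum fun i _ => ?_
      split_ifs with h
      · simp [h]
      · nlinarith [sq_nonneg (f y i), hsq (ε j), sq_nonneg (v j i)]
  have hEj : ∀ j, Fintype.card (J → Bool) * q ≤ 2 * ∑ ε, E j ε := by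
    intro j
    calc (Fintype.card (J → Bool) : ℝ≥0∞) * q = ∑ _ε : J → Bool, q := by
          rw [Finset.sum_const, nsmul_eq_mul, Finset.card_univ]
      _ ≤ ∑ ε, (E j ε + E j (flip j ε)) := Finset.sum_le_sum fun ε _ => hpair j ε
      _ = 2 * ∑ ε, E j ε := by
          rw [Finset.sum_add_distrib, (hflip j).bijective.sum_comp (fun ε => E j ε), two_mul]
  set B : ℝ≥0∞ := ((Fintype.card (J → Bool) : ℕ) : ℝ≥0∞) with hB
  set n : ℝ≥0∞ := ((Fintype.card ι : ℕ) : ℝ≥0∞) with hn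
  have hB0 : B ≠ 0 := by simp [hB]
  have hBt : B ≠ ⊤ := by simp [hB]
  have key : B * (n⁻¹ * (Fintype.card J * q)) ≤ B * (2 * R) := by
    calc B * (n⁻¹ * (Fintype.card J * q)) = n⁻¹ * ∑ _j : J, B * q := by
          rw [Finset.sum_const, nsmul_eq_mul, Finset.card_univ]
          ring
      _ ≤ n⁻¹ * ∑ j, 2 * ∑ ε, E j ε := by gcongr n⁻¹ * ∑ j, ?_ with j; exact hEj j
      _ = 2 * ∑ ε, n⁻¹ * ∑ j, E j ε := by
          rw [← Finset.mul_sum, Finset.sum_comm, ← Finset.mul_sum]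
          ring
      _ ≤ 2 * ∑ _ε : J → Bool, R := by gcongr 2 * ∑ ε, ?_ with ε; exact hEsum ε
      _ = B * (2 * R) := by
          rw [Finset.sum_const, nsmul_eq_mul, Finset.card_univ]
          ring
  have key' := (ENNReal.mul_le_mul_iff_right hB0 hBt).1 key
  have hn' : (0 : ℝ) < Fintype.card ι := by exact_mod_cast Fintype.card_pos
  have heq : n⁻¹ * (Fintype.card J * q) =
      2 * ENNReal.ofReal (Real.exp (-2) / 2 * (Fintype.card J * σ ^ 2 / Fintype.card ι)) := by
    have hn2 : n = ENNReal.ofReal (Fintype.card ι) := by simp [hn]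
    have hJ2 : (Fintype.card J : ℝ≥0∞) = ENNReal.ofReal (Fintype.card J) := by simp
    have h2 : (2 : ℝ≥0∞) = ENNReal.ofReal 2 := by simp
    have he := Real.exp_pos (-2)
    rw [hn2, hJ2, h2, hq, ← ENNReal.ofReal_inv_of_pos hn', ← ENNReal.ofReal_mul (by positivity),
      ← ENNReal.ofReal_mul (by positivity), ← ENNReal.ofReal_mul (by positivity),
      ← ENNReal.ofReal_mul (by positivity)]
    congr 1
    field_simp
  rw [heq] at key'
  exact (ENNReal.mul_le_mul_iff_right (by simp) (by simp)).1 key'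

lemma D1_mulVec (M : ℕ) (g : Fin M → ℝ) (i : Fin (M - 1)) :
    (D1 M).mulVec g i = g ⟨i + 1, by omega⟩ - g ⟨i, by omega⟩ := by
  have hi := i.2
  have h : ∀ j : Fin M, D1 M i j * g j =
      (if j = ⟨i + 1, by omega⟩ then g j else 0) - (if j = ⟨i, by omega⟩ then g j else 0) := by
    intro j
    simp only [D1, Matrix.of_apply, Fin.ext_iff]
    split_ifs <;> first | omega | simp
  simp only [Matrix.mulVec, dotProduct, h, Finset.sum_sub_distrib, Finset.sum_ite_eq',
    Finset.mem_univ, if_true]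

/-- `Dop N m` computes iterated forward differences. -/
lemma Dop_mulVec (N m : ℕ) (f : ℕ → ℝ) (i : Fin (N - m)) :
    (Dop N m).mulVec (fun j => f j) i = (fwdDiff 1)^[m] f i := by
  induction m with
  | zero =>
    have hi := i.2
    have h : ∀ j : Fin N, Dop N 0 i j * f j = if j = ⟨i, by omega⟩ then f j else 0 := by
      intro j
      simp only [Dop, Matrix.of_apply, Fin.ext_iff, eq_comm (a := (i : ℕ))]
      split_ifs <;> simp
    simp only [Matrix.mulVec, dotProduct, h, Finset.sum_ite_eq', Finset.mem_univ, if_true]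
    rfl
  | succ m ih =>
    change ((D1 (N - m) * Dop N m).mulVec _) i = _
    rw [← Matrix.mulVec_mulVec, D1_mulVec, ih, ih, Function.iterate_succ_apply']
    rfl

/-- The penalty matrix applied to a tensor product of sequences. -/
lemma ktfMat_mulVec_prod (N d m : ℕ) (f : Fin d → ℕ → ℝ) (p : KtfIdx N d m) :
    (ktfMat N d m).mulVec (fun x => ∏ l, f l (x l)) p =
      (fwdDiff 1)^[m] (f p.1) p.2.1 * ∏ l : {l : Fin d // l ≠ p.1}, f l (p.2.2 l) := by
  obtain ⟨j, i, z⟩ := p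
  dsimp only
  set g : Fin d → Fin N → ℝ := fun l t =>
    if h : l ≠ j then (if z ⟨l, h⟩ = t then 1 else 0) * f l t else Dop N m i t * f l t with hg
  have hterm : ∀ x : Fin d → Fin N,
      ktfMat N d m ⟨j, i, z⟩ x * ∏ l, f l (x l) = ∏ l, g l (x l) := by
    intro x
    rw [Fintype.prod_eq_mul_prod_subtype_ne (fun l => g l (x l)) j,
      Fintype.prod_eq_mul_prod_subtype_ne (fun l => f l (x l)) j]
    simp only [ktfMat, Matrix.of_apply]
    have h1 : g j (x j) = Dop N m i (x j) * f j (x j) := by simp [hg]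
    have h2 : ∀ l : {l : Fin d // l ≠ j},
        g l (x l) = (if z l = x l then 1 else 0) * f l (x l) := fun l => by
      simp only [hg]
      rw [dif_pos l.2]
    rw [h1, Finset.prod_congr rfl fun l _ => h2 l, Finset.prod_mul_distrib]
    ring
  simp only [Matrix.mulVec, dotProduct, hterm]
  rw [← Fintype.piFinset_univ, ← Finset.prod_univ_sum,
    Fintype.prod_eq_mul_prod_subtype_ne _ j]
  congr 1
  · rw [← Dop_mulVec]
    simp [hg, Matrix.mulVec, dotProduct]
  · refine Finset.prod_congr rfl fun l _ => ?_
    simp only [hg]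
    simp [dif_pos l.2]

/-- The penalty of a tensor product of sequences. -/
lemma sum_abs_ktfMat_mulVec_prod (N d m : ℕ) (f : Fin d → ℕ → ℝ) :
    ∑ p, |(ktfMat N d m).mulVec (fun x => ∏ l, f l (x l)) p| =
      ∑ j, (∑ i : Fin (N - m), |(fwdDiff 1)^[m] (f j) i|) *
        ∏ l : {l : Fin d // l ≠ j}, ∑ t : Fin N, |f l t| := by
  simp only [ktfMat_mulVec_prod, Fintype.sum_sigma, Fintype.sum_prod_type]
  refine Finset.sum_congr rfl fun j _ => ?_
  rw [Finset.sum_mul, Finset.prod_univ_sum, Fintype.piFinset_univ]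
  refine Finset.sum_congr rfl fun i _ => ?_
  rw [Finset.mul_sum]
  exact Finset.sum_congr rfl fun z _ => by rw [abs_mul, Finset.abs_prod]

section Bump

open Polynomial

lemma sum_abs_coeff_X_pow_mul_le {p : ℝ[X]} {B : ℝ}
    (hp : ∀ n, ∑ i ∈ Finset.range n, |p.coeff i| ≤ B) (w n : ℕ) :
    ∑ i ∈ Finset.range n, |(X ^ w * p).coeff i| ≤ B := by
  rcases le_total n w with h | h
  · rw [Finset.sum_eq_zero fun i hi => ?_]
    · simpa using hp 0
    · rw [coeff_X_pow_mul', if_neg (by have := Finset.mem_range.1 hi; omega), abs_zero]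
  · obtain ⟨t, rfl⟩ := Nat.exists_eq_add_of_le h
    rw [Finset.sum_range_add, Finset.sum_eq_zero fun i hi => ?_, zero_add]
    · simpa [add_comm w, coeff_X_pow_mul] using hp t
    · rw [coeff_X_pow_mul', if_neg (by have := Finset.mem_range.1 hi; omega), abs_zero]

/-- The polynomial `1 + X + ⋯ + X ^ (w - 1)`. -/
def geomPoly (w : ℕ) : ℝ[X] := ∑ i ∈ Finset.range w, X ^ i

lemma sum_abs_coeff_geomPoly_pow_le (w r x n : ℕ) :
    ∑ i ∈ Finset.range n, |(X ^ x * geomPoly w ^ r).coeff i| ≤ (w : ℝ) ^ r := by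
  refine sum_abs_coeff_X_pow_mul_le (fun n => ?_) x n
  induction r generalizing n with
  | zero =>
    simp only [pow_zero, coeff_one]
    calc ∑ i ∈ Finset.range n, |if i = 0 then (1 : ℝ) else 0|
        = ∑ i ∈ Finset.range n, if i = 0 then (1 : ℝ) else 0 :=
          Finset.sum_congr rfl fun i _ => by split_ifs <;> simp
      _ ≤ 1 := by rw [Finset.sum_ite_eq']; split_ifs <;> norm_num
  | succ r ih =>
    rw [pow_succ', geomPoly, Finset.sum_mul]
    calc ∑ i ∈ Finset.range n, |(∑ a ∈ Finset.range w, X ^ a * geomPoly w ^ r).coeff i|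
        ≤ ∑ i ∈ Finset.range n, ∑ a ∈ Finset.range w, |(X ^ a * geomPoly w ^ r).coeff i| := by
          refine Finset.sum_le_sum fun i _ => ?_
          rw [finsetSum_coeff]
          exact Finset.abs_sum_le_sum_abs _ _
      _ = ∑ a ∈ Finset.range w, ∑ i ∈ Finset.range n, |(X ^ a * geomPoly w ^ r).coeff i| :=
          Finset.sum_comm
      _ ≤ ∑ _a ∈ Finset.range w, (w : ℝ) ^ r :=
          Finset.sum_le_sum fun a _ => sum_abs_coeff_X_pow_mul_le ih a n
      _ = (w : ℝ) ^ (r + 1) := by simp [pow_succ']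

lemma fwdDiff_iterate_coeff (p : ℝ[X]) (r i : ℕ) :
    (fwdDiff 1)^[r] p.coeff i = ((1 - X) ^ r * p).coeff (i + r) := by
  induction r generalizing i with
  | zero => simp
  | succ r ih =>
    rw [Function.iterate_succ_apply', fwdDiff, ih, ih, pow_succ', mul_assoc, sub_mul, one_mul,
      coeff_sub, ← add_assoc, coeff_X_mul, add_right_comm]

lemma sum_abs_fwdDiff_geomPoly_pow_le (w r x n : ℕ) :
    ∑ i ∈ Finset.range n, |(fwdDiff 1)^[r] (X ^ x * geomPoly w ^ r).coeff i| ≤ 2 ^ r := by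
  have hbox : (1 - X) * geomPoly w = 1 - X ^ w := by
    rw [geomPoly, mul_neg_geom_sum]
  have hpoly : (1 - X) ^ r * (X ^ x * geomPoly w ^ r) = X ^ x * (1 - X ^ w) ^ r := by
    rw [← hbox, mul_pow]
    ring
  have hpow : ∀ n, ∑ i ∈ Finset.range n, |((1 - X ^ w) ^ r : ℝ[X]).coeff i| ≤ 2 ^ r := by
    clear hpoly
    induction r with
    | zero => simpa using sum_abs_coeff_geomPoly_pow_le w 0 0
    | succ r ih =>
      intro n
      rw [pow_succ', sub_mul, one_mul]
      calc _ ≤ ∑ i ∈ Finset.range n, (|((1 - X ^ w) ^ r : ℝ[X]).coeff i| +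
            |(X ^ w * (1 - X ^ w) ^ r : ℝ[X]).coeff i|) :=
            Finset.sum_le_sum fun i _ => by rw [coeff_sub]; exact abs_sub _ _
        _ ≤ 2 ^ r + 2 ^ r := by
            rw [Finset.sum_add_distrib]
            exact add_le_add (ih n) (sum_abs_coeff_X_pow_mul_le ih w n)
        _ = 2 ^ (r + 1) := by ring
  calc _ = ∑ i ∈ Finset.range n, |(X ^ x * (1 - X ^ w) ^ r : ℝ[X]).coeff (r + i)| :=
        Finset.sum_congr rfl fun i _ => by rw [fwdDiff_iterate_coeff, hpoly, add_comm]
    _ ≤ ∑ i ∈ Finset.range (r + n), |(X ^ x * (1 - X ^ w) ^ r : ℝ[X]).coeff i| := by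
        rw [Finset.sum_range_add]
        exact le_add_of_nonneg_left (Finset.sum_nonneg fun i _ => abs_nonneg _)
    _ ≤ 2 ^ r := sum_abs_coeff_X_pow_mul_le hpow x _

lemma natDegree_geomPoly_pow_le (w r : ℕ) : (geomPoly w ^ r).natDegree ≤ r * (w - 1) := by
  refine natDegree_pow_le_of_le r (natDegree_sum_le_of_forall_le _ _ fun i hi => ?_)
  rw [natDegree_X_pow]
  have := Finset.mem_range.1 hi
  omega

/-- The shifted bump vanishes outside `[x, x + r w)`. -/
lemma coeff_X_pow_mul_geomPoly_pow_ne_zero {w r x i : ℕ} (hw : 1 ≤ w) (hr : 1 ≤ r)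
    (h : (X ^ x * geomPoly w ^ r).coeff i ≠ 0) : x ≤ i ∧ i < x + r * w := by
  rw [coeff_X_pow_mul'] at h
  split_ifs at h with hx
  · have h1 := (le_natDegree_of_ne_zero h).trans (natDegree_geomPoly_pow_le w r)
    have h2 : r * (w - 1) < r * w := Nat.mul_lt_mul_of_pos_left (by omega) (by omega)
    omega
  · exact absurd rfl h

/-- Lower bound for the Euclidean norm of a bump that fits into `[0, N)`. -/
lemma le_sum_sq_coeff_geomPoly_pow {w r x N : ℕ} (hw : 1 ≤ w) (hr : 1 ≤ r)
    (hN : x + r * w ≤ N) :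
    ((w : ℝ) ^ r) ^ 2 / (r * w) ≤
      ∑ i ∈ Finset.range N, (X ^ x * geomPoly w ^ r).coeff i ^ 2 := by
  have hdeg : (geomPoly w ^ r).natDegree < r * w :=
    (natDegree_geomPoly_pow_le w r).trans_lt
      (Nat.mul_lt_mul_of_pos_left (by omega) (by omega))
  have hsum : ∑ i ∈ Finset.range (r * w), (geomPoly w ^ r).coeff i = (w : ℝ) ^ r := by
    have := eval_eq_sum_range' hdeg (1 : ℝ)
    simp only [one_pow, mul_one] at this
    rw [← this, eval_pow, geomPoly, eval_finsetSum]
    simp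
  have hcs := sq_sum_le_card_mul_sum_sq (s := Finset.range (r * w))
    (f := fun i => (geomPoly w ^ r).coeff i)
  rw [hsum, Finset.card_range] at hcs
  have hpos : (0 : ℝ) < r * w := by
    have : 0 < r * w := Nat.mul_pos (by omega) (by omega)
    exact_mod_cast this
  rw [div_le_iff₀' hpos]
  push_cast at hcs
  refine hcs.trans (mul_le_mul_of_nonneg_left ?_ hpos.le)
  obtain ⟨t, rfl⟩ := Nat.exists_eq_add_of_le hN
  rw [add_assoc, Finset.sum_range_add, Finset.sum_range_add]
  have h1 : ∑ i ∈ Finset.range (r * w), (geomPoly w ^ r).coeff i ^ 2 =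
      ∑ i ∈ Finset.range (r * w), (X ^ x * geomPoly w ^ r).coeff (x + i) ^ 2 :=
    Finset.sum_congr rfl fun i _ => by rw [add_comm x, coeff_X_pow_mul]
  rw [h1]
  have h2 : ∀ s : Finset ℕ, ∀ g : ℕ → ℝ, 0 ≤ ∑ i ∈ s, g i ^ 2 :=
    fun s g => Finset.sum_nonneg fun i _ => sq_nonneg _
  have h3 := h2 (Finset.range x) fun i => (X ^ x * geomPoly w ^ r).coeff i
  have h4 := h2 (Finset.range t) fun i => (X ^ x * geomPoly w ^ r).coeff (x + (r * w + i))
  linarith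

end Bump

lemma sum_abs_mulVec_sum_le {P ι J : Type*} [Fintype P] [Fintype ι] [Fintype J]
    (A : Matrix P ι ℝ) (v : J → ι → ℝ) (ε : J → ℝ) (hε : ∀ j, |ε j| = 1) :
    ∑ p, |A.mulVec (fun i => ∑ j, ε j * v j i) p| ≤ ∑ j, ∑ p, |A.mulVec (v j) p| := by
  rw [Finset.sum_comm]
  refine Finset.sum_le_sum fun p _ => ?_
  have h : A.mulVec (fun i => ∑ j, ε j * v j i) p = ∑ j, ε j * A.mulVec (v j) p := by
    simp only [Matrix.mulVec, dotProduct, Finset.mul_sum]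
    rw [Finset.sum_comm]
    exact Finset.sum_congr rfl fun j _ => Finset.sum_congr rfl fun i _ => by ring
  rw [h]
  refine (Finset.abs_sum_le_sum_abs _ _).trans (Finset.sum_le_sum fun j _ => ?_)
  rw [abs_mul, hε, one_mul]

/-- Lower bound coming from the constant vectors, which the penalty does not see. -/
lemma le_minimaxRisk_ktv_const (k d N : ℕ) (hN : 1 ≤ N) {σ Cn : ℝ} (hσ : 0 < σ) (hC : 0 < Cn) :
    ENNReal.ofReal (Real.exp (-2) / 2 * (σ ^ 2 / ((N ^ d : ℕ) : ℝ))) ≤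
      minimaxRisk
        {θ : (Fin d → Fin N) → ℝ | ∑ p, |(ktfMat N d (k + 1)).mulVec θ p| ≤ Cn} σ := by
  have : Nonempty (Fin N) := ⟨⟨0, by omega⟩⟩
  have hn : (0 : ℝ) < ((N ^ d : ℕ) : ℝ) := by positivity
  have hcard : (Fintype.card (Fin d → Fin N) : ℝ) = ((N ^ d : ℕ) : ℝ) := by simp
  have hconst : ∀ c : ℝ, (fwdDiff 1)^[k + 1] (fun _ : ℕ => c) = fun _ => 0 := by
    intro c
    induction k with
    | zero => simp
    | succ k ih => rw [Function.iterate_succ_apply', ih, fwdDiff_const]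
  have h1 : ∑ p, |(ktfMat N d (k + 1)).mulVec (fun _ => 1) p| = 0 := by
    have := sum_abs_ktfMat_mulVec_prod N d (k + 1) fun _ _ => 1
    simpa [hconst] using this
  have key := le_minimaxRisk_of_hypercube (J := Unit) hσ
    (fun _ (_ : Fin d → Fin N) => σ / √((N ^ d : ℕ) : ℝ)) (fun _ _ _ _ _ => rfl)
    (fun _ => by
      rw [Finset.sum_const, Finset.card_univ, nsmul_eq_mul, hcard, div_pow,
        Real.sq_sqrt hn.le]
      field_simp)
    {θ | ∑ p, |(ktfMat N d (k + 1)).mulVec θ p| ≤ Cn}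
    (fun ε hε => by
      refine (sum_abs_mulVec_sum_le _ _ ε hε).trans ?_
      have h2 : (fun _ : Fin d → Fin N => σ / √((N ^ d : ℕ) : ℝ)) =
          (σ / √((N ^ d : ℕ) : ℝ)) • fun _ => 1 := by ext; simp
      simp only [h2, Matrix.mulVec_smul, Pi.smul_apply, smul_eq_mul, abs_mul, ← Finset.mul_sum,
        h1]
      simpa using hC.le)
  rw [hcard] at key
  simpa using key

open Polynomial in
/-- Lower bound coming from sign combinations of `m` separated bumps of width `(k + 1) w`. -/
lemma le_minimaxRisk_ktv_bumps (k d N w M m : ℕ) (hd : 1 ≤ d) (hN : 1 ≤ N) (hw : 1 ≤ w)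
    (hM : M * ((k + 1) * w) ≤ N) (hm : m ≤ M ^ d) {σ Cn : ℝ} (hσ : 0 < σ) (hC : 0 < Cn)
    (hbudget : (m : ℝ) ^ 2 * σ ^ 2 * (((k : ℝ) + 1) * w) ^ d * (d * 2 ^ (k + 1)) ^ 2 ≤
      Cn ^ 2 * ((w : ℝ) ^ (k + 1)) ^ 2) :
    ENNReal.ofReal (Real.exp (-2) / 2 * (m * σ ^ 2 / ((N ^ d : ℕ) : ℝ))) ≤
      minimaxRisk
        {θ : (Fin d → Fin N) → ℝ | ∑ p, |(ktfMat N d (k + 1)).mulVec θ p| ≤ Cn} σ := by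
  have : Nonempty (Fin N) := ⟨⟨0, by omega⟩⟩
  have hcard : (Fintype.card (Fin d → Fin N) : ℝ) = ((N ^ d : ℕ) : ℝ) := by simp
  have hw0 : (0 : ℝ) < w := by exact_mod_cast hw
  obtain ⟨T, -, hT⟩ := Finset.exists_subset_card_eq
    (s := (Finset.univ : Finset (Fin d → Fin M))) (n := m) (by simpa using hm)
  set φ : T → Fin d → ℕ → ℝ := fun j l =>
    (X ^ ((k + 1) * w * (j.1 l : ℕ)) * geomPoly w ^ (k + 1)).coeff with hφ
  set Φ : T → (Fin d → Fin N) → ℝ := fun j x => ∏ l, φ j l (x l) with hΦ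
  set S : T → ℝ := fun j => ∑ x, Φ j x ^ 2 with hS
  set S0 : ℝ := (((w : ℝ) ^ (k + 1)) ^ 2 / (((k : ℝ) + 1) * w)) ^ d with hS0
  have hS0pos : 0 < S0 := by positivity
  have hS0le : ∀ j, S0 ≤ S j := by
    intro j
    have h1 : S j = ∏ l, ∑ t : Fin N, φ j l t ^ 2 := by
      simp only [hS, hΦ, ← Finset.prod_pow]
      rw [Finset.prod_univ_sum, Fintype.piFinset_univ]
    have h2 : S0 = ∏ _l : Fin d, ((w : ℝ) ^ (k + 1)) ^ 2 / (((k : ℝ) + 1) * w) := by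
      rw [Finset.prod_const, Finset.card_univ, Fintype.card_fin]
    rw [h1, h2]
    refine Finset.prod_le_prod (fun l _ => by positivity) fun l _ => ?_
    rw [Fin.sum_univ_eq_sum_range (fun t => φ j l t ^ 2) N]
    have hfit : (k + 1) * w * (j.1 l : ℕ) + (k + 1) * w ≤ N := by
      calc (k + 1) * w * (j.1 l : ℕ) + (k + 1) * w = ((j.1 l : ℕ) + 1) * ((k + 1) * w) := by ring
        _ ≤ M * ((k + 1) * w) := Nat.mul_le_mul_right _ (j.1 l).2
        _ ≤ N := hM
    have := le_sum_sq_coeff_geomPoly_pow hw (Nat.le_add_left 1 k) hfit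
    push_cast at this
    exact this
  have hSpos : ∀ j, 0 < S j := fun j => hS0pos.trans_le (hS0le j)
  have hpen : ∀ j, ∑ p, |(ktfMat N d (k + 1)).mulVec (Φ j) p| ≤
      d * 2 ^ (k + 1) * ((w : ℝ) ^ (k + 1)) ^ (d - 1) := by
    intro j
    simp only [hΦ]
    rw [sum_abs_ktfMat_mulVec_prod]
    calc _ ≤ ∑ i : Fin d, (2 : ℝ) ^ (k + 1) *
          ∏ _l : {l : Fin d // l ≠ i}, (w : ℝ) ^ (k + 1) := by
          refine Finset.sum_le_sum fun i _ => ?_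
          refine mul_le_mul ?_ (Finset.prod_le_prod
            (fun l _ => Finset.sum_nonneg fun _ _ => abs_nonneg _) fun l _ => ?_)
            (Finset.prod_nonneg fun l _ => Finset.sum_nonneg fun _ _ => abs_nonneg _)
            (by positivity)
          · rw [Fin.sum_univ_eq_sum_range (fun t => |(fwdDiff 1)^[k + 1] (φ j i) t|)]
            exact sum_abs_fwdDiff_geomPoly_pow_le _ _ _ _
          · rw [Fin.sum_univ_eq_sum_range (fun t => |φ j l t|)]
            exact sum_abs_coeff_geomPoly_pow_le _ _ _ _
      _ = _ := by
          simp only [Finset.prod_const, Finset.card_univ, Fintype.card_subtype_compl,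
            Fintype.card_unique, Fintype.card_fin, Finset.sum_const, nsmul_eq_mul]
          ring
  have key := le_minimaxRisk_of_hypercube (J := T) hσ (fun j x => σ / √(S j) * Φ j x)
    (fun x j j' hj hj' => by
      have hpos : 0 < (k + 1) * w := Nat.mul_pos (Nat.succ_pos k) hw
      have hcoord : ∀ j : T, Φ j x ≠ 0 → ∀ l, (j.1 l : ℕ) = x l / ((k + 1) * w) := by
        intro j hj l
        have h := coeff_X_pow_mul_geomPoly_pow_ne_zero hw (Nat.le_add_left 1 k)
          (Finset.prod_ne_zero_iff.1 hj l (Finset.mem_univ l))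
        symm
        rw [Nat.div_eq_iff hpos]
        have h1 := mul_comm ((k + 1) * w) (j.1 l : ℕ)
        omega
      refine Subtype.ext (funext fun l => Fin.ext ?_)
      rw [hcoord j (right_ne_zero_of_mul hj) l, hcoord j' (right_ne_zero_of_mul hj') l])
    (fun j => by
      simp only [mul_pow]
      rw [← Finset.mul_sum, div_pow, Real.sq_sqrt (hSpos j).le]
      exact div_mul_cancel₀ _ (hSpos j).ne')
    {θ | ∑ p, |(ktfMat N d (k + 1)).mulVec θ p| ≤ Cn}
    (fun ε hε => by
      refine (sum_abs_mulVec_sum_le _ _ ε hε).trans ?_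
      have hterm : ∀ j : T, ∑ p, |(ktfMat N d (k + 1)).mulVec (fun x => σ / √(S j) * Φ j x) p| ≤
          σ / √S0 * (d * 2 ^ (k + 1) * ((w : ℝ) ^ (k + 1)) ^ (d - 1)) := by
        intro j
        have h2 : (fun x => σ / √(S j) * Φ j x) = (σ / √(S j)) • Φ j := by ext; simp
        have h3 : |σ / √(S j)| ≤ σ / √S0 := by
          rw [abs_of_pos (div_pos hσ (Real.sqrt_pos.2 (hSpos j)))]
          exact div_le_div_of_nonneg_left hσ.le (Real.sqrt_pos.2 hS0pos)
            (Real.sqrt_le_sqrt (hS0le j))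
        simp only [h2, Matrix.mulVec_smul, Pi.smul_apply, smul_eq_mul, abs_mul, ← Finset.mul_sum]
        exact mul_le_mul h3 (hpen j) (Finset.sum_nonneg fun _ _ => abs_nonneg _) (by positivity)
      refine (Finset.sum_le_sum fun j _ => hterm j).trans ?_
      rw [Finset.sum_const, Finset.card_univ, Fintype.card_coe, hT, nsmul_eq_mul,
        div_mul_eq_mul_div, mul_div_assoc', div_le_iff₀ (Real.sqrt_pos.2 hS0pos)]
      refine le_of_sq_le_sq ?_ (by positivity)
      rw [mul_pow Cn, Real.sq_sqrt hS0pos.le, hS0, div_pow, mul_div_assoc',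
        le_div_iff₀ (by positivity)]
      obtain ⟨e, rfl⟩ : ∃ e, d = e + 1 := ⟨d - 1, by omega⟩
      rw [Nat.add_sub_cancel]
      set b : ℝ := (w : ℝ) ^ (k + 1)
      set u : ℝ := (((k : ℝ) + 1) * w) ^ (e + 1)
      set V : ℝ := ((e + 1 : ℕ) : ℝ) * 2 ^ (k + 1)
      calc _ = (m : ℝ) ^ 2 * σ ^ 2 * u * V ^ 2 * (b ^ e) ^ 2 := by ring
        _ ≤ Cn ^ 2 * b ^ 2 * (b ^ e) ^ 2 := by gcongr
        _ = _ := by ring)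
  rw [hcard, Fintype.card_coe, hT] at key
  exact key

/-- The available budget of separated bumps pays for the rate `min (σ Cn / n) σ²`. -/
lemma sparse_rate_le (k d N : ℕ) (hd : 1 ≤ d) (hkN : k + 1 ≤ N) {σ Cn R : ℝ} (hσ : 0 < σ)
    (hC : 0 < Cn) (hconst : σ ^ 2 / ((N ^ d : ℕ) : ℝ) ≤ R)
    (hbump : ∀ w M m : ℕ, 1 ≤ w → M * ((k + 1) * w) ≤ N → m ≤ M ^ d →
      (m : ℝ) ^ 2 * σ ^ 2 * (((k : ℝ) + 1) * w) ^ d * (d * 2 ^ (k + 1)) ^ 2 ≤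
        Cn ^ 2 * ((w : ℝ) ^ (k + 1)) ^ 2 → m * σ ^ 2 / ((N ^ d : ℕ) : ℝ) ≤ R) :
    min (σ * Cn / ((N ^ d : ℕ) : ℝ)) (σ ^ 2) ≤
      ((2 * ((k : ℝ) + 1)) ^ d + 2 * (d * 2 ^ (k + 1) * ((k : ℝ) + 1) ^ d)) * R := by
  have hN : 1 ≤ N := by omega
  set n : ℝ := ((N ^ d : ℕ) : ℝ) with hn
  have hn0 : 0 < n := by positivity
  have hR : 0 < R := lt_of_lt_of_le (by positivity) hconst
  set V : ℝ := d * 2 ^ (k + 1) with hV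
  set L : ℝ := V * ((k : ℝ) + 1) ^ d with hL
  have hV0 : 0 < V := by have : (0 : ℝ) < d := by exact_mod_cast hd
                         positivity
  have hL0 : 0 < L := by positivity
  set G : ℝ := (2 * ((k : ℝ) + 1)) ^ d with hG
  have hG0 : 0 < G := by positivity
  have hk1 : (1 : ℝ) ≤ ((k : ℝ) + 1) ^ d := one_le_pow₀ (by linarith [k.cast_nonneg (α := ℝ)])
  rcases lt_or_ge Cn (σ * L) with hlt | hge
  · calc _ ≤ σ * Cn / n := min_le_left _ _
      _ ≤ σ * (σ * L) / n := by gcongr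
      _ = L * (σ ^ 2 / n) := by ring
      _ ≤ L * R := by gcongr
      _ ≤ (G + 2 * L) * R := by gcongr; linarith
  set M := N / (k + 1) with hM
  have hMN : M * ((k + 1) * 1) ≤ N := by
    rw [mul_one]
    exact Nat.div_mul_le_self _ _
  have hnG : n ≤ G * (M ^ d : ℕ) := by
    have h1 : N ≤ 2 * (k + 1) * M := by
      have h2 : N < (k + 1) * (M + 1) := Nat.lt_mul_div_succ N (Nat.succ_pos k)
      have h3 : 1 ≤ M := Nat.div_pos hkN (Nat.succ_pos k)
      nlinarith
    have h4 : (N : ℝ) ≤ 2 * ((k : ℝ) + 1) * M := by exact_mod_cast h1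
    rw [hn, hG]
    push_cast
    rw [← mul_pow]
    gcongr
  set t : ℝ := Cn / (σ * L) with ht
  have ht1 : 1 ≤ t := (one_le_div (by positivity)).2 hge
  have hCt : Cn = t * (σ * L) := (div_mul_cancel₀ _ (by positivity)).symm
  have hbound : ∀ m : ℕ, m ≤ M ^ d → (m : ℝ) ≤ t → m * σ ^ 2 / n ≤ R := by
    intro m hm hmt
    refine hbump 1 M m le_rfl hMN hm ?_
    have hle : (m : ℝ) * σ * L ≤ Cn := by
      rw [hCt, mul_assoc]
      gcongr
    calc (m : ℝ) ^ 2 * σ ^ 2 * (((k : ℝ) + 1) * (1 : ℕ)) ^ d * V ^ 2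
        = (m * σ * V) ^ 2 * ((k : ℝ) + 1) ^ d := by push_cast; ring
      _ ≤ (m * σ * V) ^ 2 * (((k : ℝ) + 1) ^ d) ^ 2 := by
          gcongr
          exact le_self_pow₀ hk1 (by norm_num)
      _ = (m * σ * L) ^ 2 := by rw [hL]; ring
      _ ≤ Cn ^ 2 := by gcongr
      _ = _ := by push_cast; ring
  rcases le_total (M ^ d) ⌊t⌋₊ with hle | hle
  · have h := hbound (M ^ d) le_rfl
      ((Nat.cast_le.2 hle).trans (Nat.floor_le (by positivity)))
    calc _ ≤ σ ^ 2 := min_le_right _ _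
      _ = n * σ ^ 2 / n := by field_simp
      _ ≤ G * (M ^ d : ℕ) * σ ^ 2 / n := by gcongr
      _ = G * ((M ^ d : ℕ) * σ ^ 2 / n) := by ring
      _ ≤ G * R := by gcongr
      _ ≤ (G + 2 * L) * R := by gcongr; linarith
  · have h := hbound ⌊t⌋₊ hle (Nat.floor_le (by positivity))
    have h2 : t ≤ 2 * (⌊t⌋₊ : ℝ) := by
      have h3 := Nat.lt_floor_add_one t
      have h4 : (1 : ℝ) ≤ (⌊t⌋₊ : ℝ) := by exact_mod_cast (Nat.one_le_floor_iff t).2 ht1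
      linarith
    calc _ ≤ σ * Cn / n := min_le_left _ _
      _ = L * (t * σ ^ 2 / n) := by rw [hCt]; ring
      _ ≤ L * (2 * (⌊t⌋₊ : ℝ) * σ ^ 2 / n) := by gcongr
      _ = 2 * L * ((⌊t⌋₊ : ℝ) * σ ^ 2 / n) := by ring
      _ ≤ 2 * L * R := by gcongr
      _ ≤ (G + 2 * L) * R := by gcongr; linarith

/-- The nonparametric rate in terms of the bump width that balances bias and budget. -/
lemma smooth_rate_eq (k d : ℕ) (hd : 1 ≤ d) {σ C : ℝ} (hσ : 0 < σ) (hC : 0 < C) :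
    C ^ ((2 : ℝ) / (2 * (((k : ℝ) + 1) / d) + 1)) *
        σ ^ ((4 * (((k : ℝ) + 1) / d)) / (2 * (((k : ℝ) + 1) / d) + 1)) =
      σ ^ 2 / ((σ / C) ^ ((2 : ℝ) / (2 * k + 2 + d))) ^ d := by
  have hd0 : (0 : ℝ) < d := by exact_mod_cast hd
  set a : ℝ := (2 : ℝ) / (2 * (((k : ℝ) + 1) / d) + 1) with ha
  have h1 : (4 * (((k : ℝ) + 1) / d)) / (2 * (((k : ℝ) + 1) / d) + 1) = 2 - a := by
    rw [ha]
    field_simp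
    ring
  have h2 : (2 : ℝ) / (2 * k + 2 + d) * d = a := by
    rw [ha]
    field_simp
  rw [h1, ← Real.rpow_mul_natCast (by positivity), h2, Real.rpow_sub hσ,
    Real.div_rpow hσ.le hC.le, Real.rpow_two]
  field_simp

/-- The available budget of separated bumps pays for the nonparametric rate. -/
lemma smooth_rate_le (k d N : ℕ) (hd : 1 ≤ d) (hkN : k + 1 ≤ N) {σ Cn R : ℝ} (hσ : 0 < σ)
    (hC : 0 < Cn) (hconst : σ ^ 2 / ((N ^ d : ℕ) : ℝ) ≤ R)
    (hbump : ∀ w M m : ℕ, 1 ≤ w → M * ((k + 1) * w) ≤ N → m ≤ M ^ d →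
      (m : ℝ) ^ 2 * σ ^ 2 * (((k : ℝ) + 1) * w) ^ d * (d * 2 ^ (k + 1)) ^ 2 ≤
        Cn ^ 2 * ((w : ℝ) ^ (k + 1)) ^ 2 → m * σ ^ 2 / ((N ^ d : ℕ) : ℝ) ≤ R)
    (hlt : Cn < σ * ((N ^ d : ℕ) : ℝ)) :
    (Cn / ((N ^ d : ℕ) : ℝ)) ^ ((2 : ℝ) / (2 * (((k : ℝ) + 1) / d) + 1)) *
        σ ^ ((4 * (((k : ℝ) + 1) / d)) / (2 * (((k : ℝ) + 1) / d) + 1)) ≤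
      (4 * ((k : ℝ) + 1) * (d * 2 ^ (k + 1))) ^ d * R := by
  have hN : 1 ≤ N := by omega
  set n : ℝ := ((N ^ d : ℕ) : ℝ) with hn
  have hnpow : n = (N : ℝ) ^ d := by rw [hn]; push_cast; ring
  have hn0 : 0 < n := by positivity
  have hR : 0 < R := lt_of_lt_of_le (by positivity) hconst
  have hd1 : (1 : ℝ) ≤ d := by exact_mod_cast hd
  set L : ℝ := d * 2 ^ (k + 1) with hL
  have hL1 : 1 ≤ L := one_le_mul_of_one_le_of_one_le hd1 (one_le_pow₀ (by norm_num))
  rw [smooth_rate_eq k d hd hσ (by positivity)]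
  set r : ℝ := σ / (Cn / n) with hr
  have hrC : r * Cn = σ * n := by rw [hr]; field_simp
  have hr1 : 1 ≤ r := by
    rw [hr, one_le_div (by positivity), div_le_iff₀ hn0]
    exact hlt.le
  set x : ℝ := r ^ ((2 : ℝ) / (2 * k + 2 + d)) with hx
  have hx1 : 1 ≤ x := Real.one_le_rpow hr1 (by positivity)
  have hxq : x ^ (2 * k + 2 + d) = r ^ 2 := by
    rw [hx, ← Real.rpow_mul_natCast (by positivity), ← Real.rpow_two]
    congr 1
    push_cast
    field_simp
  set w := ⌈L * x⌉₊ with hw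
  have hLx1 : 1 ≤ L * x := one_le_mul_of_one_le_of_one_le hL1 hx1
  have hLxw : L * x ≤ w := Nat.le_ceil _
  have hw1 : 1 ≤ w := by exact_mod_cast hLx1.trans hLxw
  have hw2 : (w : ℝ) ≤ 2 * (L * x) := by
    have := Nat.ceil_lt_add_one (show 0 ≤ L * x by positivity)
    linarith
  have hw0 : (0 : ℝ) < w := by exact_mod_cast hw1
  have hwq : L ^ 2 * r ^ 2 ≤ (w : ℝ) ^ (2 * k + 2 + d) := by
    calc L ^ 2 * r ^ 2 ≤ L ^ (2 * k + 2 + d) * r ^ 2 := by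
          gcongr
          omega
      _ = (L * x) ^ (2 * k + 2 + d) := by rw [mul_pow L x, hxq]
      _ ≤ _ := by gcongr
  set D : ℝ := (4 * ((k : ℝ) + 1) * L) ^ d with hD
  have hn_le : ∀ B : ℝ, 0 ≤ B → (N : ℝ) ≤ 2 * (((k : ℝ) + 1) * w) * B → n ≤ D * x ^ d * B ^ d := by
    intro B hB h
    rw [hnpow, hD, ← mul_pow, ← mul_pow]
    refine pow_le_pow_left₀ (by positivity) (h.trans ?_) d
    calc 2 * (((k : ℝ) + 1) * w) * B ≤ 2 * (((k : ℝ) + 1) * (2 * (L * x))) * B := by gcongr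
      _ = _ := by ring
  have hfinish : ∀ m : ℝ, n ≤ D * x ^ d * m → m * σ ^ 2 / n ≤ R → σ ^ 2 / x ^ d ≤ D * R := by
    intro m h1 h2
    calc σ ^ 2 / x ^ d = n * (σ ^ 2 / (x ^ d * n)) := by field_simp
      _ ≤ D * x ^ d * m * (σ ^ 2 / (x ^ d * n)) := by gcongr
      _ = D * (m * σ ^ 2 / n) := by field_simp
      _ ≤ D * R := by gcongr
  rcases le_or_gt ((k + 1) * w) N with hwN | hwN
  · set M := N / ((k + 1) * w) with hM
    have hpos : 0 < (k + 1) * w := Nat.mul_pos (Nat.succ_pos k) hw1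
    have hMN : M * ((k + 1) * w) ≤ N := Nat.div_mul_le_self _ _
    have hNM : N ≤ 2 * ((k + 1) * w) * M := by
      have h2 : N < ((k + 1) * w) * (M + 1) := Nat.lt_mul_div_succ N hpos
      have h3 : 1 ≤ M := Nat.div_pos hwN hpos
      nlinarith
    refine hfinish ((M ^ d : ℕ) : ℝ) ?_ (hbump w M (M ^ d) hw1 hMN le_rfl ?_)
    · rw [Nat.cast_pow]
      exact hn_le M (by positivity) (by exact_mod_cast hNM)
    · set u : ℝ := (((k : ℝ) + 1) * w) ^ d with hu
      have hMu : ((M ^ d : ℕ) : ℝ) * u ≤ n := by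
        rw [hu, hnpow, Nat.cast_pow, ← mul_pow]
        gcongr
        exact_mod_cast hMN
      have hwu : (w : ℝ) ^ d ≤ u := by
        rw [hu]
        gcongr
        exact le_mul_of_one_le_left hw0.le (by linarith [k.cast_nonneg (α := ℝ)])
      have hu0 : 0 < u := by positivity
      refine le_of_mul_le_mul_right ?_ hu0
      calc ((M ^ d : ℕ) : ℝ) ^ 2 * σ ^ 2 * u * L ^ 2 * u
          = (((M ^ d : ℕ) : ℝ) * u) ^ 2 * σ ^ 2 * L ^ 2 := by ring
        _ ≤ n ^ 2 * σ ^ 2 * L ^ 2 := by gcongr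
        _ = Cn ^ 2 * (L ^ 2 * r ^ 2) := by
            calc n ^ 2 * σ ^ 2 * L ^ 2 = (σ * n) ^ 2 * L ^ 2 := by ring
              _ = _ := by rw [← hrC]; ring
        _ ≤ Cn ^ 2 * (w : ℝ) ^ (2 * k + 2 + d) := by gcongr
        _ = Cn ^ 2 * ((w : ℝ) ^ (k + 1)) ^ 2 * (w : ℝ) ^ d := by ring
        _ ≤ Cn ^ 2 * ((w : ℝ) ^ (k + 1)) ^ 2 * u := by gcongr
  · refine hfinish 1 ?_ (by simpa using hconst)
    have h := hn_le 1 zero_le_one (by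
      have : (N : ℝ) ≤ ((k : ℝ) + 1) * w := by exact_mod_cast hwN.le
      have : 0 ≤ ((k : ℝ) + 1) * w := by positivity
      linarith)
    simpa using h

/-- Theorem 4: minimax lower bound over KTV classes.  With
`s = (k+1)/d`, there is `c > 0` depending only on `k, d` such that for every `N > k+1`
(`n = N^d ≥ 2`), `σ > 0` and `0 < C_n ≤ n`, the minimax risk over
`𝒯_{n,d}^k(C_n) = {θ : ‖D_{n,d}^{(k+1)} θ‖₁ ≤ C_n}` is at least
`c [ (k+1)^d σ²/n + min(σC_n/n, σ²) + min((C_n/n)^{2/(2s+1)} σ^{4s/(2s+1)}, σ²) ]`. -/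
theorem ktv_minimax_lower_bound (k d : ℕ) (hd : 1 ≤ d) :
    ∃ c : ℝ, 0 < c ∧
      ∀ N : ℕ, k + 1 < N → 2 ≤ N ^ d →
      ∀ σ : ℝ, 0 < σ → ∀ Cn : ℝ, 0 < Cn → Cn ≤ ((N ^ d : ℕ) : ℝ) →
        ENNReal.ofReal (c *
            (((k + 1) ^ d : ℕ) * σ ^ 2 / ((N ^ d : ℕ) : ℝ) +
              min (σ * Cn / ((N ^ d : ℕ) : ℝ)) (σ ^ 2) +
              min ((Cn / ((N ^ d : ℕ) : ℝ)) ^ ((2 : ℝ) / (2 * (((k : ℝ) + 1) / d) + 1)) *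
                  σ ^ ((4 * (((k : ℝ) + 1) / d)) / (2 * (((k : ℝ) + 1) / d) + 1)))
                (σ ^ 2))) ≤
          minimaxRisk
            {θ : (Fin d → Fin N) → ℝ | ∑ p, |(ktfMat N d (k + 1)).mulVec θ p| ≤ Cn} σ := by
  have hd0 : (0 : ℝ) < d := by exact_mod_cast hd
  set c₀ : ℝ := Real.exp (-2) / 2 with hc₀
  have hc₀pos : 0 < c₀ := by positivity
  set K₁ : ℝ := (((k + 1) ^ d : ℕ) : ℝ) with hK₁
  set K₂ : ℝ := (2 * ((k : ℝ) + 1)) ^ d + 2 * (d * 2 ^ (k + 1) * ((k : ℝ) + 1) ^ d) with hK₂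
  set K₃ : ℝ := (4 * ((k : ℝ) + 1) * (d * 2 ^ (k + 1))) ^ d with hK₃
  have hK₁pos : 0 < K₁ := by positivity
  have hK₂pos : 0 < K₂ := by positivity
  have hK₃pos : 0 < K₃ := by positivity
  refine ⟨c₀ / (K₁ + K₂ + (K₂ + K₃)), by positivity, ?_⟩
  intro N hN _ σ hσ Cn hC _
  set 𝓡 := minimaxRisk
    {θ : (Fin d → Fin N) → ℝ | ∑ p, |(ktfMat N d (k + 1)).mulVec θ p| ≤ Cn} σ with h𝓡
  rcases eq_or_ne 𝓡 ⊤ with htop | htop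
  · rw [htop]
    exact le_top
  set R : ℝ := 𝓡.toReal / c₀ with hR
  have hscale : ∀ t : ℝ, ENNReal.ofReal (c₀ * t) ≤ 𝓡 → t ≤ R := by
    intro t ht
    rw [ENNReal.ofReal_le_iff_le_toReal htop] at ht
    rwa [hR, le_div_iff₀' hc₀pos]
  have hn0 : (0 : ℝ) < ((N ^ d : ℕ) : ℝ) := by
    have : 0 < N := by omega
    positivity
  have hconst := hscale _ (le_minimaxRisk_ktv_const k d N (by omega) hσ hC)
  have hbump : ∀ w M m : ℕ, 1 ≤ w → M * ((k + 1) * w) ≤ N → m ≤ M ^ d →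
      (m : ℝ) ^ 2 * σ ^ 2 * (((k : ℝ) + 1) * w) ^ d * (d * 2 ^ (k + 1)) ^ 2 ≤
        Cn ^ 2 * ((w : ℝ) ^ (k + 1)) ^ 2 → m * σ ^ 2 / ((N ^ d : ℕ) : ℝ) ≤ R :=
    fun w M m hw hM hm hbudget => hscale _
      (le_minimaxRisk_ktv_bumps k d N w M m hd (by omega) hw hM hm hσ hC hbudget)
  have hRpos : 0 < R := lt_of_lt_of_le (by positivity) hconst
  have h₂ := sparse_rate_le k d N hd (by omega) hσ hC hconst hbump
  rw [ENNReal.ofReal_le_iff_le_toReal htop, div_mul_eq_mul_div, div_le_iff₀ (by positivity),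
    show 𝓡.toReal = c₀ * R by rw [hR]; field_simp, mul_assoc]
  refine mul_le_mul_of_nonneg_left ?_ hc₀pos.le
  rw [mul_comm R, add_mul, add_mul]
  refine add_le_add (add_le_add ?_ h₂) ?_
  · rw [mul_div_assoc]
    exact mul_le_mul_of_nonneg_left hconst hK₁pos.le
  · rw [add_mul]
    rcases lt_or_ge Cn (σ * ((N ^ d : ℕ) : ℝ)) with hlt | hge
    · have h₃ := smooth_rate_le k d N hd (by omega) hσ hC hconst hbump hlt
      exact (min_le_left _ _).trans (h₃.trans (le_add_of_nonneg_left (by positivity)))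
    · have hmin : σ ^ 2 ≤ min (σ * Cn / ((N ^ d : ℕ) : ℝ)) (σ ^ 2) := by
        refine le_min ?_ le_rfl
        rw [le_div_iff₀ hn0, sq, mul_assoc]
        gcongr
      exact (min_le_right _ _).trans ((hmin.trans h₂).trans (le_add_of_nonneg_right (by positivity)))
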